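/- Let n ≥ 2 be an integer, let G₀ be an elementary abelian 2-group of order 2^{2n}, let l = 2^{n−1} + 1, and let A₁, …, A_l be subgroups of G₀ of order 2^n with A_p ∩ A_q = {e} for all p ≠ q. Set S₀ = ⋃_{i=1}^{l} (A_i ∖ {e}) and Γ₀ = Cay(G₀, S₀). Then Γ₀ is strongly regular with parameters (2^{2n}, (2^n−1)(2^{n−1}+1), 2(2^{n−1}−1)(2^{n−2}+1), 2^{n−1}(2^{n−1}+1)), and each subgroup A_i is a 2^{n−1}-regular clique of size 2^n in Γ₀. -/

import Mathlib

/-- The Cayley graph of a group `G` with connection set `S`: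
distinct vertices `x, y` are adjacent iff `y * x⁻¹ ∈ S` (symmetrised). -/
def cayley {G : Type*} [Group G] (S : Set G) : SimpleGraph G :=
  SimpleGraph.fromRel (fun x y => y * x⁻¹ ∈ S)

/-- A clique `C` is `m`-regular if every vertex not in `C` is adjacent to
exactly `m` vertices of `C`. -/
def IsRegularClique {V : Type*} (G : SimpleGraph V) (C : Set V) (m : ℕ) : Prop :=
  G.IsClique C ∧ ∀ x ∉ C, (G.neighborSet x ∩ C).ncard = m

/-- A graph is strongly regular with parameters `(v, k, l, μ)` if it is
non-complete, has `v` vertices, is `k`-regular, every two adjacent vertices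
have exactly `l` common neighbours, and every two distinct non-adjacent
vertices have exactly `μ` common neighbours. -/
def IsStronglyRegularWith {V : Type*} (G : SimpleGraph V) (v k l μ : ℕ) : Prop :=
  G ≠ ⊤ ∧ Nat.card V = v ∧ (∀ x : V, (G.neighborSet x).ncard = k) ∧
    (∀ x y : V, G.Adj x y → (G.commonNeighbors x y).ncard = l) ∧
    (∀ x y : V, x ≠ y → ¬G.Adj x y → (G.commonNeighbors x y).ncard = μ)

open Subgroup

section Cayley

variable {G : Type*} [Group G] {S : Set G}

lemma cayley_adj (h1 : 1 ∉ S) (hinv : ∀ u ∈ S, u⁻¹ ∈ S) (x y : G) :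
    (cayley S).Adj x y ↔ y * x⁻¹ ∈ S := by
  rw [cayley, SimpleGraph.fromRel_adj]
  constructor
  · rintro ⟨-, h | h⟩
    · exact h
    · simpa using hinv _ h
  · refine fun h => ⟨?_, Or.inl h⟩
    rintro rfl
    simp [h1] at h

lemma cayley_neighborSet_ncard (h1 : 1 ∉ S) (hinv : ∀ u ∈ S, u⁻¹ ∈ S) (x : G) :
    ((cayley S).neighborSet x).ncard = S.ncard := by
  rw [← Set.ncard_image_of_injective S (mul_left_injective x)]
  congr 1
  ext z
  simp [cayley_adj h1 hinv]

lemma cayley_commonNeighbors_ncard (h1 : 1 ∉ S) (hinv : ∀ u ∈ S, u⁻¹ ∈ S) (x y : G) :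
    ((cayley S).commonNeighbors x y).ncard = {u | u ∈ S ∧ u * (x * y⁻¹) ∈ S}.ncard := by
  rw [← Set.ncard_image_of_injective {u | u ∈ S ∧ u * (x * y⁻¹) ∈ S} (mul_left_injective x)]
  congr 1
  ext z
  simp [SimpleGraph.mem_commonNeighbors, cayley_adj h1 hinv, mul_assoc]

end Cayley

lemma Subgroup.IsComplement'.existsUnique_mul_mem {G : Type*} [Group G] {H K : Subgroup G}
    (h : IsComplement' H K) (g : G) : ∃! u, u ∈ H ∧ u * g ∈ K := by
  obtain ⟨⟨⟨a, ha⟩, ⟨b, hb⟩⟩, hab : a * b = g⟩ := h.2 g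
  refine ⟨a⁻¹, ⟨H.inv_mem ha, by simpa [← hab] using hb⟩, ?_⟩
  rintro v ⟨hv, hvg⟩
  have hK : v * a ∈ K := by
    have := K.mul_mem hvg (K.inv_mem hb)
    simpa [← hab, mul_assoc] using this
  exact eq_inv_of_mul_eq_one_left
    (Subgroup.disjoint_def.1 h.disjoint (H.mul_mem hv ha) hK)

section PartialSpread

variable {G ι : Type*} [Group G] {A : ι → Subgroup G}

/-- The union of a family of subgroups with the identity removed. -/
def punctured (A : ι → Subgroup G) : Set G := ⋃ p, ((A p : Set G) \ {1})

lemma mem_punctured {u : G} : u ∈ punctured A ↔ u ≠ 1 ∧ ∃ p, u ∈ A p := by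
  simp [punctured, and_comm]

lemma one_notMem_punctured : (1 : G) ∉ punctured A := by simp [mem_punctured]

lemma inv_mem_punctured (u : G) (hu : u ∈ punctured A) : u⁻¹ ∈ punctured A := by
  simpa [mem_punctured] using hu

lemma index_eq_of_mem (hA : ∀ p q, p ≠ q → IsComplement' (A p) (A q)) {p q : ι} {u : G}
    (hu : u ≠ 1) (hp : u ∈ A p) (hq : u ∈ A q) : p = q := by
  by_contra hpq
  exact hu (Subgroup.disjoint_def.1 (hA p q hpq).disjoint hp hq)

/-- A translate of a component meets the punctured union in one point of each other component. -/
lemma ncard_translate_inter_punctured [Finite ι]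
    (hA : ∀ p q, p ≠ q → IsComplement' (A p) (A q)) {p : ι} {g : G} (hg : g ∉ A p) :
    {u | u ∈ A p ∧ u * g ∈ punctured A}.ncard = Nat.card ι - 1 := by
  have hne : ∀ u ∈ A p, u * g ≠ 1 := fun u hu h =>
    hg (by simpa [eq_inv_of_mul_eq_one_right h] using hu)
  choose f hf _ using fun q : {q // q ≠ p} => (hA p q q.2.symm).existsUnique_mul_mem g
  have hinj : Function.Injective f := fun a b hab =>
    Subtype.ext (index_eq_of_mem hA (hne _ (hf a).1) (hf a).2 (hab ▸ (hf b).2))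
  have hrange : {u | u ∈ A p ∧ u * g ∈ punctured A} = Set.range f := by
    ext u
    constructor
    · rintro ⟨hu, hug⟩
      obtain ⟨h1, q, hq⟩ := mem_punctured.1 hug
      have hqp : q ≠ p := by
        rintro rfl
        exact hg ((Subgroup.mul_mem_cancel_left _ hu).1 hq)
      exact ⟨⟨q, hqp⟩, ((hA p q hqp.symm).existsUnique_mul_mem g).unique (hf ⟨q, hqp⟩) ⟨hu, hq⟩⟩
    · rintro ⟨q, rfl⟩
      exact ⟨(hf q).1, mem_punctured.2 ⟨hne _ (hf q).1, q, (hf q).2⟩⟩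
  rw [hrange, ← Nat.card_coe_set_eq, Nat.card_range_of_injective hinj]
  classical
  have := Fintype.ofFinite ι
  simp [Nat.card_eq_fintype_card]

lemma ncard_punctured_sep [Finite G] [Fintype ι]
    (hA : ∀ p q, p ≠ q → IsComplement' (A p) (A q)) (P : G → Prop) :
    {u | u ∈ punctured A ∧ P u}.ncard = ∑ p, {u | (u ∈ A p ∧ P u) ∧ u ≠ 1}.ncard := by
  rw [← finsum_eq_sum_of_fintype, ← Set.ncard_iUnion_of_finite (fun _ => Set.toFinite _)]
  · congr 1
    ext u
    simp only [mem_punctured, Set.mem_iUnion, Set.mem_ofPred_eq]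
    tauto
  · intro p q hpq
    refine Set.disjoint_left.2 ?_
    rintro u ⟨⟨hp, -⟩, h1⟩ ⟨⟨hq, -⟩, -⟩
    exact hpq (index_eq_of_mem hA h1 hp hq)

lemma ncard_punctured [Finite G] [Fintype ι]
    (hA : ∀ p q, p ≠ q → IsComplement' (A p) (A q)) {m : ℕ} (hm : ∀ p, Nat.card (A p) = m) :
    (punctured A).ncard = Fintype.card ι * (m - 1) := by
  have h := ncard_punctured_sep hA fun _ => True
  have hp : ∀ p, {u | (u ∈ A p ∧ True) ∧ u ≠ 1}.ncard = m - 1 := fun p => by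
    have hset : {u | (u ∈ A p ∧ True) ∧ u ≠ 1} = (A p : Set G) \ {1} := by
      ext u
      simp
    rw [hset, Set.ncard_sdiff_singleton_of_mem (A p).one_mem, ← hm p]
    rfl
  rw [Finset.sum_congr rfl fun p _ => hp p] at h
  simpa using h

lemma ncard_punctured_translate_of_notMem [Finite G] [Fintype ι]
    (hA : ∀ p q, p ≠ q → IsComplement' (A p) (A q)) {g : G} (hg1 : g ≠ 1)
    (hg : g ∉ punctured A) :
    {u | u ∈ punctured A ∧ u * g ∈ punctured A}.ncard
      = Fintype.card ι * (Fintype.card ι - 1) := by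
  rw [ncard_punctured_sep hA]
  have hp : ∀ p, {u | (u ∈ A p ∧ u * g ∈ punctured A) ∧ u ≠ 1}.ncard = Fintype.card ι - 1 := by
    intro p
    have hgp : g ∉ A p := fun h => hg (mem_punctured.2 ⟨hg1, p, h⟩)
    rw [← Nat.card_eq_fintype_card, ← ncard_translate_inter_punctured hA hgp]
    congr 1
    ext u
    refine and_iff_left_of_imp ?_
    rintro ⟨-, hu⟩ rfl
    exact hg (by simpa using hu)
  simp [hp]

lemma ncard_punctured_translate_of_mem [Finite G] [Fintype ι]
    (hA : ∀ p q, p ≠ q → IsComplement' (A p) (A q)) {m : ℕ} (hm : ∀ p, Nat.card (A p) = m)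
    {g : G} (hg : g ∈ punctured A) :
    {u | u ∈ punctured A ∧ u * g ∈ punctured A}.ncard
      = (m - 2) + (Fintype.card ι - 1) * (Fintype.card ι - 2) := by
  classical
  obtain ⟨hg1, s, hs⟩ := mem_punctured.1 hg
  rw [ncard_punctured_sep hA, ← Finset.add_sum_erase _ _ (Finset.mem_univ s)]
  congr 1
  · have hset : {u | (u ∈ A s ∧ u * g ∈ punctured A) ∧ u ≠ 1} = (A s : Set G) \ {1, g⁻¹} := by
      ext u
      simp only [mem_punctured, Set.mem_ofPred_eq, Set.mem_sdiff, SetLike.mem_coe,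
        Set.mem_insert_iff, Set.mem_singleton_iff, not_or, ne_eq, mul_eq_one_iff_eq_inv]
      constructor
      · tauto
      · rintro ⟨hu, h1, h2⟩
        exact ⟨⟨hu, h2, s, (A s).mul_mem hu hs⟩, h1⟩
    rw [hset, Set.ncard_sdiff, Set.ncard_pair (by simpa [eq_comm] using hg1), ← hm s]
    · rfl
    · rintro u (rfl | rfl)
      · exact (A s).one_mem
      · exact (A s).inv_mem hs
  · have hp : ∀ p ∈ Finset.univ.erase s,
        {u | (u ∈ A p ∧ u * g ∈ punctured A) ∧ u ≠ 1}.ncard = Fintype.card ι - 2 := by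
      intro p hps
      have hgp : g ∉ A p := fun h => Finset.ne_of_mem_erase hps (index_eq_of_mem hA hg1 h hs)
      have hset : {u | (u ∈ A p ∧ u * g ∈ punctured A) ∧ u ≠ 1}
          = {u | u ∈ A p ∧ u * g ∈ punctured A} \ {1} := rfl
      have hone : (1 : G) ∈ {u | u ∈ A p ∧ u * g ∈ punctured A} :=
        ⟨(A p).one_mem, by simpa using hg⟩
      rw [hset, Set.ncard_sdiff_singleton_of_mem hone,
        ncard_translate_inter_punctured hA hgp, Nat.card_eq_fintype_card, Nat.sub_sub]
    rw [Finset.sum_congr rfl hp]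
    simp

lemma isRegularClique_cayley_punctured [Finite ι]
    (hA : ∀ p q, p ≠ q → IsComplement' (A p) (A q)) (p : ι) :
    IsRegularClique (cayley (punctured A)) (A p : Set G) (Nat.card ι - 1) := by
  refine ⟨fun x hx y hy hxy => ?_, fun x hx => ?_⟩
  · rw [cayley_adj one_notMem_punctured inv_mem_punctured, mem_punctured]
    exact ⟨fun h => hxy (mul_inv_eq_one.1 h).symm, p, (A p).mul_mem hy ((A p).inv_mem hx)⟩
  · rw [← ncard_translate_inter_punctured hA (g := x⁻¹) (by simpa using hx)]
    congr 1
    ext z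
    simp [cayley_adj one_notMem_punctured inv_mem_punctured, and_comm]

end PartialSpread

theorem statement16 (n : ℕ) (hn : 2 ≤ n)
    (G₀ : Type*) [CommGroup G₀] [Finite G₀]
    (hG₀card : Nat.card G₀ = 2 ^ (2 * n)) (hG₀el : ∀ x : G₀, x * x = 1)
    (A : Fin (2 ^ (n - 1) + 1) → Subgroup G₀)
    (hAcard : ∀ p, Nat.card (A p) = 2 ^ n)
    (hAint : ∀ p q, p ≠ q → A p ⊓ A q = ⊥)
    (S₀ : Set G₀) (hS₀def : S₀ = ⋃ p, ((A p : Set G₀) \ {1})) :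
    IsStronglyRegularWith (cayley S₀) (2 ^ (2 * n))
        ((2 ^ n - 1) * (2 ^ (n - 1) + 1))
        (2 * (2 ^ (n - 1) - 1) * (2 ^ (n - 2) + 1))
        (2 ^ (n - 1) * (2 ^ (n - 1) + 1)) ∧
    ∀ p, IsRegularClique (cayley S₀) ((A p : Set G₀)) (2 ^ (n - 1)) ∧
      ((A p : Set G₀)).ncard = 2 ^ n := by
  have hA : ∀ p q, p ≠ q → IsComplement' (A p) (A q) := fun p q hpq =>
    isComplement'_of_card_mul_and_disjoint
      (by rw [hAcard, hAcard, hG₀card, ← pow_add, two_mul]) (disjoint_iff.2 (hAint p q hpq))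
  replace hS₀def : S₀ = punctured A := hS₀def
  subst hS₀def
  obtain ⟨k, rfl⟩ := Nat.exists_eq_add_of_le' hn
  have hpos : 0 < 2 ^ k := by positivity
  have h1 : 2 ^ (k + 2 - 1) = 2 * 2 ^ k := by rw [← pow_succ']; rfl
  have h2 : 2 ^ (k + 2) = 4 * 2 ^ k := by ring
  have hdeg : (punctured A).ncard = (2 ^ (k + 2) - 1) * (2 ^ (k + 2 - 1) + 1) := by
    rw [ncard_punctured hA hAcard, Fintype.card_fin, mul_comm]
  refine ⟨⟨?_, hG₀card, fun x => ?_, fun x y hxy => ?_, fun x y hne hxy => ?_⟩, fun p => ⟨?_, ?_⟩⟩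
  · intro htop
    have hnbr := cayley_neighborSet_ncard (S := punctured A)
      one_notMem_punctured inv_mem_punctured 1
    rw [htop, SimpleGraph.neighborSet_top, hdeg, Set.ncard_compl, Set.ncard_singleton, hG₀card,
      mul_comm 2 (k + 2), pow_mul, h1, h2] at hnbr
    obtain ⟨t, ht⟩ : ∃ t, 2 ^ k = t + 1 := ⟨2 ^ k - 1, by omega⟩
    rw [ht] at hnbr
    have h3 : (4 * (t + 1)) ^ 2 - 1 = 16 * t ^ 2 + 32 * t + 15 :=
      Nat.sub_eq_of_eq_add (by ring)
    have h4 : 4 * (t + 1) - 1 = 4 * t + 3 := by omega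
    rw [h3, h4] at hnbr
    nlinarith
  · rw [cayley_neighborSet_ncard one_notMem_punctured inv_mem_punctured, hdeg]
  · rw [SimpleGraph.adj_comm, cayley_adj one_notMem_punctured inv_mem_punctured] at hxy
    rw [cayley_commonNeighbors_ncard one_notMem_punctured inv_mem_punctured,
      ncard_punctured_translate_of_mem hA hAcard hxy, Fintype.card_fin, h1, h2,
      Nat.add_sub_cancel k 2]
    obtain ⟨t, ht⟩ : ∃ t, 2 ^ k = t + 1 := ⟨2 ^ k - 1, by omega⟩
    rw [ht, show 4 * (t + 1) - 2 = 4 * t + 2 by omega,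
      show 2 * (t + 1) + 1 - 1 = 2 * t + 2 by omega,
      show 2 * (t + 1) + 1 - 2 = 2 * t + 1 by omega,
      show 2 * (t + 1) - 1 = 2 * t + 1 by omega]
    ring
  · rw [SimpleGraph.adj_comm, cayley_adj one_notMem_punctured inv_mem_punctured] at hxy
    rw [cayley_commonNeighbors_ncard one_notMem_punctured inv_mem_punctured,
      ncard_punctured_translate_of_notMem hA (fun h => hne (mul_inv_eq_one.1 h)) hxy,
      Fintype.card_fin, Nat.add_sub_cancel, mul_comm]
  · simpa using isRegularClique_cayley_punctured hA p
  · exact hAcard p
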